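/- Suppose the reduced scheme (Algorithm 3) holds with δγ − 1 ≥ 0, δβ_{k+1} ≤ δβ_k + α_kβ_k, β_k positive nondecreasing with β_k → ∞ and α_k > 0, and suppose (ε_k) is nonincreasing with ε_k ≥ 0, Σ_{k=1}^{∞} α_kε_k < +∞ and β_kε_k → +∞. Let x̄* be the minimal norm solution of min f(x) subject to Ax = b, and assume there is a dual multiplier λ̄* such that (x̄*, λ̄*) is a saddle point of L. Then liminf_{k→∞} ‖x_k − x̄*‖ = 0. Moreover, if there exists an integer K ≥ 1 such that either ‖x_k‖ ≥ ‖x̄*‖ for all k ≥ K or ‖x_k‖ < ‖x̄*‖ for all k ≥ K, then lim_{k→∞} ‖x_k − x̄*‖ = 0. -/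

import Mathlib

open Filter Topology
open scoped RealInnerProductSpace

section MinimalNorm

variable {X : Type*} [NormedAddCommGroup X] [InnerProductSpace ℝ X]

lemma norm_sub_sq_eq_parallelogram (x y : X) :
    ‖x - y‖ ^ 2 = 2 * ‖x‖ ^ 2 + 2 * ‖y‖ ^ 2 - 4 * ‖(1 / 2 : ℝ) • x + (1 / 2 : ℝ) • y‖ ^ 2 := by
  rw [← smul_add, norm_smul, mul_pow, norm_sub_sq_real, norm_add_sq_real]
  norm_num
  ring

/-- If `p` is the minimal norm zero of a nonnegative continuous convex function `φ`, then points
where `φ` is small cannot have a norm much smaller than `‖p‖`. -/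
lemma exists_sublevel_norm_sq_lower_bound [CompleteSpace X] {φ : X → ℝ}
    (hconv : ConvexOn ℝ Set.univ φ) (hcont : Continuous φ) (hnn : ∀ y, 0 ≤ φ y) {p : X}
    (hp : φ p = 0) (hmin : ∀ y, φ y = 0 → ‖p‖ ≤ ‖y‖) {η : ℝ} (hη : 0 < η) :
    ∃ ρ > 0, ∀ y, φ y ≤ ρ → ‖p‖ ^ 2 - η ≤ ‖y‖ ^ 2 := by
  by_contra! hcon
  have hpos : ∀ n : ℕ, (0 : ℝ) < 1 / ((n : ℝ) + 1) := fun n => Nat.one_div_pos_of_nat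
  have hproj : ∀ n : ℕ, ∃ q, φ q ≤ 1 / ((n : ℝ) + 1) ∧
      ∀ y, φ y ≤ 1 / ((n : ℝ) + 1) → ‖q‖ ≤ ‖y‖ := by
    intro n
    have hclosed : IsClosed {y | φ y ≤ 1 / ((n : ℝ) + 1)} := isClosed_le hcont continuous_const
    have hcvx : Convex ℝ {y | φ y ≤ 1 / ((n : ℝ) + 1)} := by
      simpa using hconv.convex_le (1 / ((n : ℝ) + 1))
    obtain ⟨q, hq, hqinf⟩ := exists_norm_eq_iInf_of_complete_convex
      ⟨p, by simpa [hp] using (hpos n).le⟩ hclosed.isComplete hcvx 0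
    refine ⟨q, hq, fun y hy => ?_⟩
    have hle := ciInf_le (f := fun w : {y | φ y ≤ 1 / ((n : ℝ) + 1)} => ‖(0 : X) - w‖)
      ⟨0, by rintro _ ⟨w, rfl⟩; exact norm_nonneg _⟩ ⟨y, hy⟩
    rw [← hqinf] at hle
    simpa using hle
  choose q hqφ hqmin using hproj
  have hmono : Monotone fun n : ℕ => ‖q n‖ ^ 2 := by
    intro n m hnm
    have := hqmin n (q m) ((hqφ m).trans (Nat.one_div_le_one_div hnm))
    dsimp only
    gcongr
  have hbound : ∀ n, ‖q n‖ ^ 2 ≤ ‖p‖ ^ 2 - η := by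
    intro n
    obtain ⟨y, hy, hylt⟩ := hcon _ (hpos n)
    have := hqmin n y hy
    exact le_trans (by gcongr) hylt.le
  have hlim := tendsto_atTop_ciSup hmono ⟨_, by rintro _ ⟨n, rfl⟩; exact hbound n⟩
  have hdist : ∀ n m, n ≤ m → ‖q m - q n‖ ^ 2 ≤ 2 * (‖q m‖ ^ 2 - ‖q n‖ ^ 2) := by
    intro n m hnm
    have hmem : φ ((1 / 2 : ℝ) • q m + (1 / 2 : ℝ) • q n) ≤ 1 / ((n : ℝ) + 1) := by
      have h := hconv.2 (Set.mem_univ (q m)) (Set.mem_univ (q n))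
        (by norm_num : (0 : ℝ) ≤ 1 / 2) (by norm_num : (0 : ℝ) ≤ 1 / 2) (by norm_num)
      have h1 := (hqφ m).trans (Nat.one_div_le_one_div (α := ℝ) hnm)
      have h2 := hqφ n
      simp only [smul_eq_mul] at h
      linarith
    have hnorm := hqmin n _ hmem
    have hsq : ‖q n‖ ^ 2 ≤ ‖(1 / 2 : ℝ) • q m + (1 / 2 : ℝ) • q n‖ ^ 2 := by gcongr
    rw [norm_sub_sq_eq_parallelogram]
    linarith
  have hcauchy : CauchySeq q := by
    rw [Metric.cauchySeq_iff']
    intro e he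
    obtain ⟨N, hN⟩ := Metric.cauchySeq_iff'.1 hlim.cauchySeq (e ^ 2 / 2) (by positivity)
    refine ⟨N, fun n hn => ?_⟩
    have h1 := hN n hn
    rw [Real.dist_eq] at h1
    have h2 := hdist N n hn
    rw [dist_eq_norm]
    refine lt_of_pow_lt_pow_left₀ 2 he.le ?_
    linarith [le_abs_self (‖q n‖ ^ 2 - ‖q N‖ ^ 2)]
  obtain ⟨r, hr⟩ := cauchySeq_tendsto_of_complete hcauchy
  have hφr : φ r ≤ 0 := le_of_tendsto_of_tendsto' ((hcont.tendsto r).comp hr)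
    tendsto_one_div_add_atTop_nhds_zero_nat hqφ
  have hrnorm : ‖r‖ ^ 2 ≤ ‖p‖ ^ 2 - η := le_of_tendsto' (hr.norm.pow 2) hbound
  have hpr := hmin r (le_antisymm hφr (hnn r))
  have : ‖p‖ ^ 2 ≤ ‖r‖ ^ 2 := by gcongr
  linarith

/-- Approximate zeros of `φ` whose norm is almost at most that of the minimal norm zero `p` are
close to `p`. -/
lemma exists_norm_sub_lt_of_approximate_zero [CompleteSpace X] {φ : X → ℝ}
    (hconv : ConvexOn ℝ Set.univ φ) (hcont : Continuous φ) (hnn : ∀ y, 0 ≤ φ y) {p : X}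
    (hp : φ p = 0) (hmin : ∀ y, φ y = 0 → ‖p‖ ≤ ‖y‖) {η : ℝ} (hη : 0 < η) :
    ∃ ρ > 0, ∀ y, φ y ≤ ρ → ‖y‖ ^ 2 ≤ ‖p‖ ^ 2 + ρ → ‖y - p‖ < η := by
  obtain ⟨ρ, hρ, hlow⟩ := exists_sublevel_norm_sq_lower_bound hconv hcont hnn hp hmin
    (η := η ^ 2 / 8) (by positivity)
  refine ⟨min ρ (η ^ 2 / 8), lt_min hρ (by positivity), fun y hy hyn => ?_⟩
  have h := hconv.2 (Set.mem_univ y) (Set.mem_univ p)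
    (by norm_num : (0 : ℝ) ≤ 1 / 2) (by norm_num : (0 : ℝ) ≤ 1 / 2) (by norm_num)
  simp only [smul_eq_mul, hp] at h
  have hle := hlow ((1 / 2 : ℝ) • y + (1 / 2 : ℝ) • p)
    (by linarith [hnn y, min_le_left ρ (η ^ 2 / 8)])
  refine lt_of_pow_lt_pow_left₀ 2 hη.le ?_
  rw [norm_sub_sq_eq_parallelogram]
  linarith [min_le_right ρ (η ^ 2 / 8), pow_pos hη 2]

end MinimalNorm

/-- Kronecker's lemma for nonnegative summable sequences. -/
lemma tendsto_weighted_sum_div_atTop {a w : ℕ → ℝ} (ha : ∀ k, 0 ≤ a k) (hsum : Summable a)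
    (hw : ∀ k, 0 < w k) (hmono : Monotone w) (htop : Tendsto w atTop atTop) :
    Tendsto (fun n => (∑ i ∈ Finset.range n, w i * a i) / w n) atTop (𝓝 0) := by
  have hconv : ∀ n, (∑ i ∈ Finset.range n, w i * a i) / w n =
      ∑' i, if i < n then w i * a i / w n else 0 := by
    intro n
    rw [tsum_eq_sum (s := Finset.range n) (by intro i hi; simp_all), Finset.sum_div]
    exact Finset.sum_congr rfl fun i hi => by simp [Finset.mem_range.1 hi]
  simp_rw [hconv]
  rw [← tsum_zero (α := ℝ) (β := ℕ)]
  refine tendsto_tsum_of_dominated_convergence hsum (fun i => ?_) (Eventually.of_forall ?_)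
  · have h : Tendsto (fun n => w i * a i / w n) atTop (𝓝 0) := htop.const_div_atTop _
    refine h.congr' ?_
    filter_upwards [eventually_gt_atTop i] with n hn
    simp [hn]
  · intro n i
    split_ifs with h
    · rw [Real.norm_of_nonneg (div_nonneg (mul_nonneg (hw i).le (ha i)) (hw n).le),
        div_le_iff₀ (hw n), mul_comm]
      exact mul_le_mul_of_nonneg_left (hmono h.le) (ha i)
    · simpa using ha i

/-- The increments `(αₖβₖ + δβₖ) rₖ₊₁ - δβₖ rₖ` of a sequence growing slower than `β` force the
residuals `r` to vanish. -/
lemma tendsto_residual_zero {Z : Type*} [NormedAddCommGroup Z] [NormedSpace ℝ Z]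
    {δ : ℝ} (hδ : 0 < δ) {α β M : ℕ → ℝ} (hβ : ∀ k, 0 < β k)
    (hββ : ∀ k, δ * β (k + 1) ≤ δ * β k + α k * β k) (hβtop : Tendsto β atTop atTop)
    {l r : ℕ → Z}
    (hl : ∀ k, l (k + 1) - l k = (α k * β k + δ * β k) • r (k + 1) - (δ * β k) • r k)
    (hlM : ∀ k, ‖l k‖ ≤ M k) (hM : Monotone M)
    (hMβ : Tendsto (fun k => M k / β k) atTop (𝓝 0)) : Tendsto r atTop (𝓝 0) := by
  have hu : ∀ k, ‖l k - (δ * β k) • r k‖ ≤ ‖l 0 - (δ * β 0) • r 0‖ + M k := by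
    intro k
    induction k with
    | zero => linarith [norm_nonneg (l 0), hlM 0]
    | succ k ih =>
      have hpos : 0 < δ * β (k + 1) := mul_pos hδ (hβ _)
      set c := (α k * β k + δ * β k) / (δ * β (k + 1)) with hc
      have hc1 : 1 ≤ c := by rw [hc, one_le_div hpos]; linarith [hββ k]
      have hcm : c * (δ * β (k + 1)) = α k * β k + δ * β k := by
        rw [hc, div_mul_cancel₀ _ hpos.ne']
      have hrec : c • (l (k + 1) - (δ * β (k + 1)) • r (k + 1)) =
          (l k - (δ * β k) • r k) + (c - 1) • l (k + 1) := by
        rw [smul_sub, smul_smul, hcm, sub_smul, one_smul]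
        have h := hl k
        rw [sub_eq_iff_eq_add] at h
        have h2 : (α k * β k + δ * β k) • r (k + 1) =
            l (k + 1) - l k + (δ * β k) • r k := by rw [h]; abel
        rw [h2]; abel
      have hnorm := norm_add_le (l k - (δ * β k) • r k) ((c - 1) • l (k + 1))
      rw [← hrec, norm_smul, norm_smul, Real.norm_of_nonneg (by linarith),
        Real.norm_of_nonneg (by linarith)] at hnorm
      have h1 : (c - 1) * ‖l (k + 1)‖ ≤ (c - 1) * M (k + 1) :=
        mul_le_mul_of_nonneg_left (hlM _) (by linarith)
      have h2 := hM (Nat.le_succ k)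
      have h3 : 0 ≤ (c - 1) * ‖l 0 - (δ * β 0) • r 0‖ :=
        mul_nonneg (by linarith) (norm_nonneg _)
      refine le_of_mul_le_mul_left (?_ : c * _ ≤ c * _) (by linarith)
      simp only [Nat.succ_eq_add_one] at h2
      linarith
  have hr : ∀ k, ‖r k‖ ≤ (‖l 0 - (δ * β 0) • r 0‖ / β k + 2 * (M k / β k)) / δ := by
    intro k
    have h := norm_sub_le (l k) (l k - (δ * β k) • r k)
    rw [sub_sub_cancel, norm_smul, Real.norm_of_nonneg (mul_pos hδ (hβ k)).le] at h
    rw [le_div_iff₀ hδ, mul_div_assoc', ← add_div, le_div_iff₀ (hβ k)]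
    linarith [hu k, hlM k]
  refine squeeze_zero_norm hr ?_
  simpa using ((hβtop.const_div_atTop _).add (hMβ.const_mul 2)).div_const δ

section Energy

variable {X Z : Type*} [NormedAddCommGroup X] [InnerProductSpace ℝ X] [CompleteSpace X]
  [NormedAddCommGroup Z] [InnerProductSpace ℝ Z] [CompleteSpace Z]

lemma norm_sub_sq_sub_norm_sub_sq {E : Type*} [NormedAddCommGroup E] [InnerProductSpace ℝ E]
    (y₁ y₀ p : E) :
    ‖y₁ - p‖ ^ 2 - ‖y₀ - p‖ ^ 2 = 2 * ⟪y₁ - y₀, y₁ - p⟫ - ‖y₁ - y₀‖ ^ 2 := by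
  have h := norm_sub_sq_real (y₁ - p) (y₁ - y₀)
  rw [sub_sub_sub_cancel_left, real_inner_comm] at h
  linarith

/-- Decrease of the quadratic part of the energy along one step of the reduced scheme. -/
lemma quadratic_energy_step {f : X → ℝ} (A : X →L[ℝ] Z) {b : Z} {μ δ γ α β ε : ℝ}
    (hμ : 0 ≤ μ) (hδ : 0 < δ) (hα : 0 < α) (hβ : 0 < β) (hε : 0 ≤ ε) (hδγ : 0 ≤ δ * γ - 1)
    {x₀ x₁ d₀ d₁ u p : X} {l₀ l₁ q : Z} (hp : A p = b)
    (hu₀ : ⟪u, x₀ - x₁⟫ ≤ f x₀ - f x₁)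
    (hup : ⟪u, p - x₁⟫ + μ / 2 * ‖p - x₁‖ ^ 2 ≤ f p - f x₁)
    (hd : α • (d₁ - x₁) = δ • (x₁ - x₀))
    (hdd : d₁ - d₀ = -((δ * α * β) • (u + ContinuousLinearMap.adjoint A l₁ + ε • x₁
        - μ • (x₁ - d₁))) - (δ * γ - 1) • (x₁ - x₀))
    (hl : l₁ - l₀ = (α * β) • (A d₁ - b)) :
    (1 / 2 * ‖d₁ - p‖ ^ 2 + (δ * γ - 1) / 2 * ‖x₁ - p‖ ^ 2 + δ / 2 * ‖l₁ - q‖ ^ 2)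
      + δ * (α * β + δ * β) * ((f x₁ + ⟪q, A x₁ - b⟫ - f p) + ε / 2 * ‖x₁‖ ^ 2)
    ≤ (1 / 2 * ‖d₀ - p‖ ^ 2 + (δ * γ - 1) / 2 * ‖x₀ - p‖ ^ 2 + δ / 2 * ‖l₀ - q‖ ^ 2)
      + δ ^ 2 * β * ((f x₀ + ⟪q, A x₀ - b⟫ - f p) + ε / 2 * ‖x₀‖ ^ 2)
      + δ * α * β * ε * (‖p‖ ^ 2 / 2) := by
  subst hp
  have hd' : ∀ v : X, α * ⟪v, d₁ - x₁⟫ = δ * ⟪v, x₁ - x₀⟫ := fun v => by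
    rw [← real_inner_smul_right, hd, real_inner_smul_right]
  have hsplit : d₁ - p = (x₁ - p) + (d₁ - x₁) := by abel
  have hD := norm_sub_sq_sub_norm_sub_sq d₁ d₀ p
  have hX := norm_sub_sq_sub_norm_sub_sq x₁ x₀ p
  have hL := norm_sub_sq_sub_norm_sub_sq l₁ l₀ q
  have hLin : ⟪l₁ - l₀, l₁ - q⟫ =
      α * β * ⟪ContinuousLinearMap.adjoint A l₁, d₁ - p⟫ - α * β * ⟪q, A (d₁ - p)⟫ := by
    rw [hl, real_inner_smul_left, ContinuousLinearMap.adjoint_inner_left, ← map_sub,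
      inner_sub_right, real_inner_comm, real_inner_comm q]
    ring
  have hDin : ⟪d₁ - d₀, d₁ - p⟫ = -(δ * α * β) * (⟪u, d₁ - p⟫
      + ⟪ContinuousLinearMap.adjoint A l₁, d₁ - p⟫ + ε * ⟪x₁, d₁ - p⟫
      - μ * ⟪x₁ - d₁, d₁ - p⟫) - (δ * γ - 1) * ⟪x₁ - x₀, d₁ - p⟫ := by
    rw [hdd]
    simp only [inner_sub_left (𝕜 := ℝ) _ _ (d₁ - p), inner_neg_left, real_inner_smul_left,
      inner_add_left]
    ring
  have hv : ∀ v : X, α * ⟪v, d₁ - p⟫ = α * ⟪v, x₁ - p⟫ + δ * ⟪v, x₁ - x₀⟫ := fun v => by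
    rw [hsplit, inner_add_right, mul_add, hd']
  have hu := hv u
  have hx := hv x₁
  have hw := hv (x₁ - x₀)
  have hA := hv (ContinuousLinearMap.adjoint A q)
  simp only [ContinuousLinearMap.adjoint_inner_left] at hA
  have hμin : ‖x₁ - p‖ ^ 2 = ‖x₁ - d₁‖ ^ 2 + 2 * ⟪x₁ - d₁, d₁ - p⟫ + ‖d₁ - p‖ ^ 2 := by
    rw [← norm_add_sq_real, sub_add_sub_cancel]
  have hxp : ‖p‖ ^ 2 = ‖x₁‖ ^ 2 - 2 * ⟪x₁, x₁ - p⟫ + ‖x₁ - p‖ ^ 2 := by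
    rw [← norm_sub_sq_real, sub_sub_cancel]
  have hxx : ‖x₀‖ ^ 2 = ‖x₁‖ ^ 2 - 2 * ⟪x₁, x₁ - x₀⟫ + ‖x₁ - x₀‖ ^ 2 := by
    rw [← norm_sub_sq_real, sub_sub_cancel]
  rw [← neg_sub x₁ x₀, inner_neg_right] at hu₀
  rw [← neg_sub x₁ p, inner_neg_right, norm_neg] at hup
  have hA₁ : ⟪q, A x₁ - A p⟫ = ⟪q, A (x₁ - p)⟫ := by rw [map_sub]
  have hA₀ : ⟪q, A x₀ - A p⟫ = ⟪q, A (x₁ - p)⟫ - ⟪q, A (x₁ - x₀)⟫ := by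
    rw [← inner_sub_right, ← map_sub, ← map_sub]; congr 2; abel
  have hw' : ⟪x₁ - x₀, x₁ - p⟫ ≤ ⟪x₁ - x₀, d₁ - p⟫ := by
    refine le_of_mul_le_mul_left ?_ hα
    rw [hw, real_inner_self_eq_norm_sq]
    exact le_add_of_nonneg_right (by positivity)
  rw [hA₁, hA₀]
  generalize δ * γ - 1 = s at *
  linear_combination 1 / 2 * hD + hDin + s / 2 * hX + δ / 2 * hL + δ * hLin - δ * β * hu
    - δ * β * ε * hx - δ * β * hA - δ * α * β * μ / 2 * hμin + δ * α * β * hup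
    - δ * α * β * ε / 2 * hxp - δ ^ 2 * β * ε / 2 * hxx + δ ^ 2 * β * hu₀ + s * hw'
    + 1 / 2 * sq_nonneg ‖d₁ - d₀‖ + s / 2 * sq_nonneg ‖x₁ - x₀‖
    + δ / 2 * sq_nonneg ‖l₁ - l₀‖ + δ * α * β * ε / 2 * sq_nonneg ‖x₁ - p‖
    + δ ^ 2 * β * ε / 2 * sq_nonneg ‖x₁ - x₀‖
    + δ * α * β * μ / 2 * sq_nonneg ‖x₁ - d₁‖ + δ * α * β * μ / 2 * sq_nonneg ‖d₁ - p‖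

end Energy

section ScalarRecursion

variable {R ell h α β ε : ℕ → ℝ} {δ H : ℝ}

lemma regularized_energy_le (hδ : 0 < δ) (hβ : ∀ k, 0 < β k) (hε : ∀ k, 0 ≤ ε k)
    (hεmono : ∀ k, ε (k + 1) ≤ ε k) (hββ : ∀ k, δ * β (k + 1) ≤ δ * β k + α k * β k)
    (hell : ∀ k, 0 ≤ ell k) (hh : ∀ k, 0 ≤ h k)
    (hstep : ∀ k, R (k + 1) + δ * (α k * β k + δ * β k) * (ell (k + 1) + ε k * h (k + 1)) ≤
      R k + δ ^ 2 * β k * (ell k + ε k * h k) + δ * α k * β k * ε k * H) (n : ℕ) :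
    R n + δ ^ 2 * β n * (ell n + ε n * h n) ≤
      R 0 + δ ^ 2 * β 0 * (ell 0 + ε 0 * h 0) +
        δ * H * ∑ i ∈ Finset.range n, β i * (α i * ε i) := by
  induction n with
  | zero => simp
  | succ n ih =>
    rw [Finset.sum_range_succ]
    have h1 : δ * (δ * β (n + 1)) * (ell (n + 1) + ε (n + 1) * h (n + 1)) ≤
        δ * (α n * β n + δ * β n) * (ell (n + 1) + ε n * h (n + 1)) := by
      have hpos : 0 < δ * β (n + 1) := mul_pos hδ (hβ _)
      have := hell (n + 1)
      have := hh (n + 1)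
      have := hε (n + 1)
      have := hε n
      refine mul_le_mul (mul_le_mul_of_nonneg_left (by linarith [hββ n]) hδ.le)
        (by gcongr; exact hεmono n) (by positivity) (mul_nonneg hδ.le (by linarith [hββ n]))
    linarith [hstep n]

lemma energy_le_of_le (hδ : 0 < δ) (hε : ∀ k, 0 ≤ ε k) (hβ : ∀ k, 0 < β k)
    (hεmono : ∀ k, ε (k + 1) ≤ ε k) (hββ : ∀ k, δ * β (k + 1) ≤ δ * β k + α k * β k)
    (hell : ∀ k, 0 ≤ ell k) {N : ℕ} (hh : ∀ k, N ≤ k → H ≤ h k)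
    (hstep : ∀ k, R (k + 1) + δ * (α k * β k + δ * β k) * (ell (k + 1) + ε k * h (k + 1)) ≤
      R k + δ ^ 2 * β k * (ell k + ε k * h k) + δ * α k * β k * ε k * H) {n : ℕ} (hn : N ≤ n) :
    R n + δ ^ 2 * β n * (ell n + ε n * (h n - H)) ≤
      R N + δ ^ 2 * β N * (ell N + ε N * (h N - H)) := by
  induction n, hn using Nat.le_induction with
  | base => exact le_rfl
  | succ n hn ih =>
    have h1 : δ * (δ * β (n + 1)) * (ell (n + 1) + ε (n + 1) * (h (n + 1) - H)) ≤
        δ * (α n * β n + δ * β n) * (ell (n + 1) + ε n * (h (n + 1) - H)) := by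
      have hpos : 0 < δ * β (n + 1) := mul_pos hδ (hβ _)
      have := hell (n + 1)
      have hH : 0 ≤ h (n + 1) - H := by linarith [hh (n + 1) (by omega)]
      have := hε (n + 1)
      have := hε n
      refine mul_le_mul (mul_le_mul_of_nonneg_left (by linarith [hββ n]) hδ.le)
        (by gcongr; exact hεmono n) (by positivity) (mul_nonneg hδ.le (by linarith [hββ n]))
    linarith [hstep n]

end ScalarRecursion

theorem strong_convergence_reduced_algorithm
    {X Z : Type*}
    [NormedAddCommGroup X] [InnerProductSpace ℝ X] [CompleteSpace X]
    [NormedAddCommGroup Z] [InnerProductSpace ℝ Z] [CompleteSpace Z]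
    (f : X → ℝ)
    (hfconv : ConvexOn ℝ Set.univ f) (hfcont : Continuous f)
    (A : X →L[ℝ] Z) (b : Z)
    (μf : ℝ) (hμf : 0 ≤ μf)
    (hfS : ∀ x u v : X, (∀ w, f w - f x ≥ ⟪v, w - x⟫) →
        f u - f x - ⟪v, u - x⟫ ≥ μf / 2 * ‖u - x‖ ^ 2)
    (L : X → Z → ℝ)
    (hL : ∀ x l, L x l = f x + ⟪l, A x - b⟫)
    (δ γ : ℝ) (hδ : 0 < δ) (hγ : 0 < γ)
    (α β ε : ℕ → ℝ)
    (hα : ∀ k, 1 ≤ k → 0 < α k)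
    (hβpos : ∀ k, 1 ≤ k → 0 < β k)
    (hβmono : ∀ k, 1 ≤ k → β k ≤ β (k + 1))
    (hεnn : ∀ k, 1 ≤ k → 0 ≤ ε k)
    (hβtop : Tendsto β atTop atTop)
    (x : ℕ → X) (lam : ℕ → Z) (Zs Zd : ℕ → X)
    (hZ : ∀ k, 1 ≤ k → Zs (k + 1) = (1 / α k) • (x (k + 1) - x k) + γ • x (k + 1))
    (hZd : ∀ k, 1 ≤ k → Zd (k + 1) = δ • Zs (k + 1) + (1 - δ * γ) • x (k + 1))
    (hlam : ∀ k, 1 ≤ k → lam (k + 1) = lam k + (α k * β k) • (A (Zd (k + 1)) - b))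
    (hstep : ∀ k, 1 ≤ k → ∃ u,
        (∀ w, f w - f (x (k + 1)) ≥ ⟪u, w - x (k + 1)⟫) ∧
        (1 / α k) • (Zs (k + 1) - Zs k) =
          -(β k • (u + (ContinuousLinearMap.adjoint A) (lam (k + 1)) + ε k • x (k + 1)
              - μf • (x (k + 1) - Zd (k + 1)))))
    (hδγ : δ * γ - 1 ≥ 0)
    (hββ : ∀ k, 1 ≤ k → δ * β (k + 1) ≤ δ * β k + α k * β k)
    (hεmono : ∀ k, 1 ≤ k → ε (k + 1) ≤ ε k)
    (hsum : Summable (fun k => α k * ε k))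
    (hβεtop : Tendsto (fun k => β k * ε k) atTop atTop)
    (xs : X) (ls : Z)
    (hsaddle : ∀ x' l', L xs l' ≤ L xs ls ∧ L xs ls ≤ L x' ls)
    (hfeas : A xs = b)
    (hopt : ∀ x', A x' = b → f xs ≤ f x')
    (hmn : ∀ x', A x' = b → (∀ x'', A x'' = b → f x' ≤ f x'') → ‖xs‖ ≤ ‖x'‖)
    :
    liminf (fun k => ‖x k - xs‖) atTop = 0 ∧
    ((∃ K : ℕ, 1 ≤ K ∧
        ((∀ k, K ≤ k → ‖xs‖ ≤ ‖x k‖) ∨ (∀ k, K ≤ k → ‖x k‖ < ‖xs‖))) →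
      Tendsto (fun k => ‖x k - xs‖) atTop (𝓝 0)) := by
  set φ : X → ℝ := fun y => (f y + ⟪ls, A y - b⟫ - f xs) + ‖A y - b‖ with hφdef
  have hell : ∀ y, 0 ≤ f y + ⟪ls, A y - b⟫ - f xs := by
    intro y
    have h := (hsaddle y ls).2
    rw [hL, hL, hfeas, sub_self, inner_zero_right] at h
    linarith
  have hφnn : ∀ y, 0 ≤ φ y := fun y => add_nonneg (hell y) (norm_nonneg _)
  have hφxs : φ xs = 0 := by simp [hφdef, hfeas]
  have hφcont : Continuous φ := by fun_prop
  have hφconv : ConvexOn ℝ Set.univ φ := by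
    refine ⟨convex_univ, fun y _ z _ s t hs ht hst => ?_⟩
    have h1 := hfconv.2 (Set.mem_univ y) (Set.mem_univ z) hs ht hst
    have h2 : A (s • y + t • z) - b = s • (A y - b) + t • (A z - b) := by
      have hb : b = s • b + t • b := by rw [← add_smul, hst, one_smul]
      rw [map_add, map_smul, map_smul, smul_sub, smul_sub]
      nth_rewrite 1 [hb]
      abel
    have h3 := norm_add_le (s • (A y - b)) (t • (A z - b))
    rw [norm_smul, norm_smul, Real.norm_of_nonneg hs, Real.norm_of_nonneg ht] at h3
    simp only [hφdef, smul_eq_mul] at h1 ⊢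
    rw [h2, inner_add_right, real_inner_smul_right, real_inner_smul_right]
    have h4 : f xs = s * f xs + t * f xs := by rw [← add_mul, hst, one_mul]
    linarith
  have hφmin : ∀ y, φ y = 0 → ‖xs‖ ≤ ‖y‖ := by
    intro y hy
    have h1 : ‖A y - b‖ = 0 := by
      have := hell y
      have := norm_nonneg (A y - b)
      simp only [hφdef] at hy
      linarith
    have hA : A y = b := sub_eq_zero.1 (norm_eq_zero.1 h1)
    refine hmn y hA fun z hz => ?_
    have h2 : f y = f xs := by
      simp only [hφdef, hA, sub_self, inner_zero_right, norm_zero] at hy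
      linarith
    exact h2 ▸ hopt z hz
  -- The point `Zd 1` is unconstrained, so the analysis starts at index `2`.
  set R : ℕ → ℝ := fun k => 1 / 2 * ‖Zd (k + 2) - xs‖ ^ 2
    + (δ * γ - 1) / 2 * ‖x (k + 2) - xs‖ ^ 2 + δ / 2 * ‖lam (k + 2) - ls‖ ^ 2 with hR
  set ell : ℕ → ℝ := fun k => f (x (k + 2)) + ⟪ls, A (x (k + 2)) - b⟫ - f xs with hell_def
  have hZd' : ∀ k, 1 ≤ k → Zd (k + 1) - x (k + 1) = (δ / α k) • (x (k + 1) - x k) := by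
    intro k hk
    rw [hZd k hk, hZ k hk]
    module
  have hαZd : ∀ k, 1 ≤ k → α k • (Zd (k + 1) - x (k + 1)) = δ • (x (k + 1) - x k) := by
    intro k hk
    rw [hZd' k hk, smul_smul, mul_div_cancel₀ _ (hα k hk).ne']
  have henergy : ∀ k, R (k + 1) + δ * (α (k + 2) * β (k + 2) + δ * β (k + 2)) *
      (ell (k + 1) + ε (k + 2) * (‖x (k + 1 + 2)‖ ^ 2 / 2)) ≤
      R k + δ ^ 2 * β (k + 2) * (ell k + ε (k + 2) * (‖x (k + 2)‖ ^ 2 / 2))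
        + δ * α (k + 2) * β (k + 2) * ε (k + 2) * (‖xs‖ ^ 2 / 2) := by
    intro k
    have hk : 1 ≤ k + 2 := by omega
    obtain ⟨u, hu, hustep⟩ := hstep (k + 2) hk
    have hdd : Zd (k + 2 + 1) - Zd (k + 2) = -((δ * α (k + 2) * β (k + 2)) •
        (u + ContinuousLinearMap.adjoint A (lam (k + 2 + 1)) + ε (k + 2) • x (k + 2 + 1)
          - μf • (x (k + 2 + 1) - Zd (k + 2 + 1)))) - (δ * γ - 1) • (x (k + 2 + 1) - x (k + 2)) := by
      have hZdiff : Zs (k + 2 + 1) - Zs (k + 2) =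
          α (k + 2) • ((1 / α (k + 2)) • (Zs (k + 2 + 1) - Zs (k + 2))) := by
        rw [smul_smul, mul_one_div_cancel (hα _ hk).ne', one_smul]
      rw [hustep] at hZdiff
      have hdiff : Zd (k + 2 + 1) - Zd (k + 2) = δ • (Zs (k + 2 + 1) - Zs (k + 2))
          - (δ * γ - 1) • (x (k + 2 + 1) - x (k + 2)) := by
        have h2 : Zd (k + 2) = δ • Zs (k + 2) + (1 - δ * γ) • x (k + 2) := hZd (k + 1) (by omega)
        rw [hZd _ hk, h2]
        module
      rw [hdiff, hZdiff, smul_neg, smul_neg, smul_smul, smul_smul]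
    have hup := hfS (x (k + 2 + 1)) xs u hu
    have h := quadratic_energy_step A (q := ls) hμf hδ (hα _ hk) (hβpos _ hk) (hεnn _ hk) hδγ
      hfeas (hu (x (k + 2))) (by linarith) (hαZd _ hk) hdd (by rw [hlam _ hk]; abel)
    simp only [hR, hell_def, show k + 1 + 2 = k + 2 + 1 by omega]
    linarith
  have hββ' : ∀ k, δ * β (k + 1 + 2) ≤ δ * β (k + 2) + α (k + 2) * β (k + 2) :=
    fun k => hββ (k + 2) (by omega)
  have hβ' : ∀ k, 0 < β (k + 2) := fun k => hβpos _ (by omega)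
  have hε' : ∀ k, 0 ≤ ε (k + 2) := fun k => hεnn _ (by omega)
  have hε'mono : ∀ k, ε (k + 1 + 2) ≤ ε (k + 2) := fun k => hεmono (k + 2) (by omega)
  have hβ'mono : Monotone fun k => β (k + 2) :=
    monotone_nat_of_le_succ fun k => hβmono (k + 2) (by omega)
  have hβ'top : Tendsto (fun k => β (k + 2)) atTop atTop := (tendsto_add_atTop_iff_nat 2).2 hβtop
  have haε : ∀ k, 0 ≤ α (k + 2) * ε (k + 2) :=
    fun k => mul_nonneg (hα _ (by omega)).le (hε' k)
  have hRnn : ∀ k, 0 ≤ R k := fun k => by positivity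
  have hhnn : ∀ k, 0 ≤ ‖x (k + 2)‖ ^ 2 / 2 := fun k => by positivity
  set W : ℕ → ℝ := fun n => R 0 + δ ^ 2 * β (0 + 2) * (ell 0 + ε (0 + 2) * (‖x (0 + 2)‖ ^ 2 / 2)) +
    δ * (‖xs‖ ^ 2 / 2) * ∑ i ∈ Finset.range n, β (i + 2) * (α (i + 2) * ε (i + 2)) with hW
  have hRW : ∀ n, R n + δ ^ 2 * β (n + 2) * (ell n + ε (n + 2) * (‖x (n + 2)‖ ^ 2 / 2)) ≤ W n :=
    regularized_energy_le (β := fun k => β (k + 2)) (ε := fun k => ε (k + 2))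
      (α := fun k => α (k + 2)) (h := fun k => ‖x (k + 2)‖ ^ 2 / 2) hδ hβ' hε' hε'mono hββ'
      (fun k => hell _) hhnn henergy
  have hWmono : Monotone W := by
    refine monotone_nat_of_le_succ fun n => ?_
    simp only [hW, Finset.sum_range_succ]
    have := mul_nonneg (hβ' n).le (haε n)
    gcongr
    linarith
  have hWβ : Tendsto (fun n => W n / β (n + 2)) atTop (𝓝 0) := by
    have h1 := tendsto_weighted_sum_div_atTop haε ((summable_nat_add_iff 2).2 hsum) hβ' hβ'mono
      hβ'top
    have h2 := (hβ'top.const_div_atTop (R 0 + δ ^ 2 * β (0 + 2) *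
      (ell 0 + ε (0 + 2) * (‖x (0 + 2)‖ ^ 2 / 2)))).add (h1.const_mul (δ * (‖xs‖ ^ 2 / 2)))
    rw [mul_zero, add_zero] at h2
    refine h2.congr fun n => ?_
    simp only [hW]
    ring
  have hell_lim : Tendsto ell atTop (𝓝 0) := by
    have h1 := hWβ.div_const (δ ^ 2)
    rw [zero_div] at h1
    refine squeeze_zero (fun k => hell _) (fun n => ?_) h1
    rw [le_div_iff₀ (by positivity), le_div_iff₀ (hβ' n)]
    have h2 : 0 ≤ δ ^ 2 * β (n + 2) * (ε (n + 2) * (‖x (n + 2)‖ ^ 2 / 2)) :=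
      mul_nonneg (mul_nonneg (by positivity) (hβ' n).le) (mul_nonneg (hε' n) (hhnn n))
    linarith [hRW n, hRnn n]
  have hres_lim : Tendsto (fun k => A (x (k + 2)) - b) atTop (𝓝 0) := by
    refine tendsto_residual_zero hδ (α := fun k => α (k + 2)) (β := fun k => β (k + 2))
      (M := fun k => 1 + 2 / δ * W k) (l := fun k => lam (k + 2) - ls) hβ' hββ' hβ'top ?_ ?_ ?_ ?_
    · intro k
      have hk : 1 ≤ k + 2 := by omega
      have h1 : A (Zd (k + 2 + 1)) = A (x (k + 2 + 1))
          + (δ / α (k + 2)) • (A (x (k + 2 + 1)) - A (x (k + 2))) := by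
        rw [← map_sub, ← map_smul, ← hZd' _ hk, ← map_add, add_sub_cancel]
      simp only [show k + 1 + 2 = k + 2 + 1 by omega]
      rw [hlam _ hk, h1]
      have h2 : α (k + 2) * β (k + 2) * (δ / α (k + 2)) = δ * β (k + 2) := by
        have := (hα _ hk).ne'
        field_simp
      rw [← h2]
      module
    · intro k
      have h1 : δ / 2 * ‖lam (k + 2) - ls‖ ^ 2 ≤ W k := by
        have h2 : 0 ≤ δ ^ 2 * β (k + 2) * (ell k + ε (k + 2) * (‖x (k + 2)‖ ^ 2 / 2)) :=
          mul_nonneg (mul_nonneg (by positivity) (hβ' k).le)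
            (add_nonneg (hell _) (mul_nonneg (hε' k) (hhnn k)))
        have h3 : 0 ≤ 1 / 2 * ‖Zd (k + 2) - xs‖ ^ 2
          + (δ * γ - 1) / 2 * ‖x (k + 2) - xs‖ ^ 2 := by positivity
        have h4 := hRW k
        simp only [hR] at h4
        linarith
      have h2 : ‖lam (k + 2) - ls‖ ^ 2 ≤ 2 / δ * W k := by
        rw [div_mul_eq_mul_div, le_div_iff₀ hδ]
        linarith
      nlinarith [sq_nonneg (‖lam (k + 2) - ls‖ - 1), sq_nonneg ‖lam (k + 2) - ls‖]
    · intro m n hmn'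
      have := hWmono hmn'
      dsimp only
      gcongr
    · have h1 := (hβ'top.const_div_atTop 1).add (hWβ.const_mul (2 / δ))
      rw [mul_zero, add_zero] at h1
      refine h1.congr fun n => ?_
      ring
  have hφ_lim : Tendsto (fun k => φ (x k)) atTop (𝓝 0) := by
    refine (tendsto_add_atTop_iff_nat 2).1 ?_
    simpa using hell_lim.add hres_lim.norm
  have hclose : ∀ η > 0, ∃ ρ > 0, ∀ᶠ k in atTop,
      ‖x k‖ ^ 2 ≤ ‖xs‖ ^ 2 + ρ → ‖x k - xs‖ < η := by
    intro η hη
    obtain ⟨ρ, hρ, h⟩ := exists_norm_sub_lt_of_approximate_zero hφconv hφcont hφnn hφxs hφmin hη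
    exact ⟨ρ, hρ, (hφ_lim.eventually_le_const hρ).mono fun k hk => h _ hk⟩
  have hlim_of_norm : (∀ ρ > 0, ∀ᶠ k in atTop, ‖x k‖ ^ 2 ≤ ‖xs‖ ^ 2 + ρ) →
      Tendsto (fun k => ‖x k - xs‖) atTop (𝓝 0) := by
    intro h
    refine tendsto_order.2 ⟨fun a ha => Eventually.of_forall fun k =>
      ha.trans_le (norm_nonneg _), fun η hη => ?_⟩
    obtain ⟨ρ, hρ, hk⟩ := hclose η hη
    filter_upwards [hk, h ρ hρ] with k h1 h2 using h1 h2
  have hlim_large : ∀ K : ℕ, (∀ k, K ≤ k → ‖xs‖ ≤ ‖x k‖) →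
      Tendsto (fun k => ‖x k - xs‖) atTop (𝓝 0) := by
    intro K hK
    refine hlim_of_norm fun ρ hρ => ?_
    have hh : ∀ k, K ≤ k → ‖xs‖ ^ 2 / 2 ≤ ‖x (k + 2)‖ ^ 2 / 2 := by
      intro k hk
      have := hK (k + 2) (by omega)
      gcongr
    set C := R K + δ ^ 2 * β (K + 2) *
      (ell K + ε (K + 2) * (‖x (K + 2)‖ ^ 2 / 2 - ‖xs‖ ^ 2 / 2))
    have hbound : ∀ n, K ≤ n → R n + δ ^ 2 * β (n + 2) *
        (ell n + ε (n + 2) * (‖x (n + 2)‖ ^ 2 / 2 - ‖xs‖ ^ 2 / 2)) ≤ C := fun n hn =>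
      energy_le_of_le (R := R) (ell := ell) (β := fun k => β (k + 2)) (ε := fun k => ε (k + 2))
        (α := fun k => α (k + 2)) (h := fun k => ‖x (k + 2)‖ ^ 2 / 2) hδ hε' hβ' hε'mono hββ'
        (fun k => hell _) hh henergy hn
    have hβε' := (tendsto_add_atTop_iff_nat 2).2 hβεtop
    have hev : ∀ᶠ n in atTop, ‖x (n + 2)‖ ^ 2 ≤ ‖xs‖ ^ 2 + ρ := by
      filter_upwards [hβε'.eventually_ge_atTop (2 * C / (δ ^ 2 * ρ)),
        hβε'.eventually_gt_atTop 0, eventually_ge_atTop K] with n h1 h2 h3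
      rw [div_le_iff₀ (by positivity)] at h1
      have h4 : 0 ≤ δ ^ 2 * β (n + 2) * ell n :=
        mul_nonneg (mul_nonneg (by positivity) (hβ' n).le) (hell _)
      have h5 := hbound n h3
      have h6 := hRnn n
      have hpos : 0 < δ ^ 2 * (β (n + 2) * ε (n + 2)) := by positivity
      refine le_of_mul_le_mul_left ?_ hpos
      linarith
    obtain ⟨N, hN⟩ := eventually_atTop.1 hev
    refine eventually_atTop.2 ⟨N + 2, fun n hn => ?_⟩
    have h := hN (n - 2) (by omega)
    rwa [Nat.sub_add_cancel (by omega)] at h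
  constructor
  · by_cases hcase : ∃ K : ℕ, ∀ k, K ≤ k → ‖xs‖ ≤ ‖x k‖
    · obtain ⟨K, hK⟩ := hcase
      exact (hlim_large K hK).liminf_eq
    · have hfreq : ∃ᶠ k in atTop, ‖x k‖ < ‖xs‖ := by
        rw [frequently_atTop]
        push Not at hcase
        exact hcase
      have hsmall : ∀ η > 0, ∃ᶠ k in atTop, ‖x k - xs‖ ≤ η := by
        intro η hη
        obtain ⟨ρ, hρ, hk⟩ := hclose η hη
        refine (hfreq.and_eventually hk).mono fun k h => (h.2 ?_).le
        have : ‖x k‖ ^ 2 ≤ ‖xs‖ ^ 2 := by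
          have := h.1.le
          gcongr
        linarith
      have hbdd : IsBoundedUnder (· ≥ ·) atTop fun k => ‖x k - xs‖ :=
        isBoundedUnder_of ⟨0, fun k => norm_nonneg _⟩
      refine le_antisymm (le_of_forall_pos_le_add fun η hη => ?_) ?_
      · rw [zero_add]
        exact liminf_le_of_frequently_le (hsmall η hη) hbdd
      · exact le_liminf_of_le (IsCobounded.of_frequently_le (hsmall 1 one_pos))
          (Eventually.of_forall fun k => norm_nonneg _)
  · rintro ⟨K, -, hK | hK⟩
    · exact hlim_large K hK
    · refine hlim_of_norm fun ρ hρ => ?_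
      filter_upwards [eventually_ge_atTop K] with k hk
      have : ‖x k‖ ^ 2 ≤ ‖xs‖ ^ 2 := by
        have := (hK k hk).le
        gcongr
      linarith
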